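/- Regularity: For every n ∈ ℕ, if φ₁,...,φ_m ⊢_{[-1]} ψ then □ⁿφ₁,...,□ⁿφ_m ⊢_{[-1]} □ⁿψ. -/

import Mathlib

universe u v

namespace BQL

structure Signature : Type 1 where
  Const : Type
  Func : Type
  arityF : Func → ℕ
  Rel : Type
  arityR : Rel → ℕ

inductive Term (L : Signature) : Type
  | var : ℕ → Term L
  | const : L.Const → Term L
  | func : (f : L.Func) → (Fin (L.arityF f) → Term L) → Term L

inductive Formula (L : Signature) : Type
  | top : Formula L
  | bot : Formula L
  | rel : (R : L.Rel) → (Fin (L.arityR R) → Term L) → Formula L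
  | and : Formula L → Formula L → Formula L
  | or : Formula L → Formula L → Formula L
  | imp : Formula L → Formula L → Formula L
  | all : Formula L → Formula L
  | ex : Formula L → Formula L

variable {L : Signature}

namespace Term

/-- Shift all (free) variables of a term up by one. -/
def shiftUp : Term L → Term L
  | var n => var (n + 1)
  | const c => const c
  | func f ts => func f fun i => (ts i).shiftUp

/-- Apply a simultaneous substitution to a term. -/
def applySub (σ : ℕ → Term L) : Term L → Term L
  | var n => σ n
  | const c => const c
  | func f ts => func f fun i => (ts i).applySub σ

/-- All variables of the term are `< k`. -/
def ClosedAt : Term L → ℕ → Prop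
  | var n, k => n < k
  | const _, _ => True
  | func _ ts, k => ∀ i, (ts i).ClosedAt k

/-- A closed term. -/
def Closed (t : Term L) : Prop := t.ClosedAt 0

/-- The constant `c` occurs in the term. -/
def OccC (c : L.Const) : Term L → Prop
  | var _ => False
  | const d => d = c
  | func _ ts => ∃ i, (ts i).OccC c

end Term

/-- Lift a substitution under a binder. -/
def liftSub (σ : ℕ → Term L) : ℕ → Term L
  | 0 => .var 0
  | n + 1 => (σ n).shiftUp

namespace Formula

/-- Apply a simultaneous substitution to a formula. -/
def applySub (σ : ℕ → Term L) : Formula L → Formula L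
  | top => top
  | bot => bot
  | rel R ts => rel R fun i => (ts i).applySub σ
  | and φ ψ => and (φ.applySub σ) (ψ.applySub σ)
  | or φ ψ => or (φ.applySub σ) (ψ.applySub σ)
  | imp φ ψ => imp (φ.applySub σ) (ψ.applySub σ)
  | all φ => all (φ.applySub (liftSub σ))
  | ex φ => ex (φ.applySub (liftSub σ))

/-- All free variables of the formula are `< k`. -/
def ClosedAt : Formula L → ℕ → Prop
  | top, _ => True
  | bot, _ => True
  | rel _ ts, k => ∀ i, (ts i).ClosedAt k
  | and φ ψ, k => φ.ClosedAt k ∧ ψ.ClosedAt k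
  | or φ ψ, k => φ.ClosedAt k ∧ ψ.ClosedAt k
  | imp φ ψ, k => φ.ClosedAt k ∧ ψ.ClosedAt k
  | all φ, k => φ.ClosedAt (k + 1)
  | ex φ, k => φ.ClosedAt (k + 1)

/-- A sentence: a formula with no free variables. -/
def Sentence (φ : Formula L) : Prop := φ.ClosedAt 0

/-- The constant `c` occurs in the formula. -/
def OccC (c : L.Const) : Formula L → Prop
  | top => False
  | bot => False
  | rel _ ts => ∃ i, (ts i).OccC c
  | and φ ψ => φ.OccC c ∨ ψ.OccC c
  | or φ ψ => φ.OccC c ∨ ψ.OccC c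
  | imp φ ψ => φ.OccC c ∨ ψ.OccC c
  | all φ => φ.OccC c
  | ex φ => φ.OccC c

/-- The formula contains no occurrence of `∨` and no occurrence of `∃`. -/
def NoOrEx : Formula L → Prop
  | top => True
  | bot => True
  | rel _ _ => True
  | and φ ψ => φ.NoOrEx ∧ ψ.NoOrEx
  | or _ _ => False
  | imp φ ψ => φ.NoOrEx ∧ ψ.NoOrEx
  | all φ => φ.NoOrEx
  | ex _ => False

end Formula

/-- Substitute the term `t` for the variable `v₀` (lowering the other variables). -/
def subst0 (φ : Formula L) (t : Term L) : Formula L :=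
  φ.applySub fun n => match n with | 0 => t | n + 1 => .var n

/-- `□ⁿφ`, where `□φ` abbreviates `⊤ → φ`. -/
def boxN : ℕ → Formula L → Formula L
  | 0, φ => φ
  | n + 1, φ => .imp .top (boxN n φ)

/-- The conjunction of a finite list of formulas (`⋀∅ = ⊤`). -/
def conjL : List (Formula L) → Formula L
  | [] => .top
  | [φ] => φ
  | φ :: ψ :: l => .and φ (conjL (ψ :: l))

/-- The language `L⁺`, obtained from `L` by adding countably many fresh constants `aᵢ`. -/
def Signature.plus (L : Signature) : Signature where
  Const := L.Const ⊕ ℕ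
  Func := L.Func
  arityF := L.arityF
  Rel := L.Rel
  arityR := L.arityR

/-- The fresh constant `aᵢ` of `L⁺`. -/
def aconst (L : Signature) (i : ℕ) : Term L.plus := .const (Sum.inr i)

/-- Embedding of `L`-terms into `L⁺`-terms. -/
def Term.emb : Term L → Term L.plus
  | .var n => .var n
  | .const c => .const (Sum.inl c)
  | .func f ts => .func f fun i => (ts i).emb

/-- Embedding of `L`-formulas into `L⁺`-formulas. -/
def Formula.emb : Formula L → Formula L.plus
  | .top => .top
  | .bot => .bot
  | .rel R ts => .rel R fun i => (ts i).emb
  | .and φ ψ => .and φ.emb ψ.emb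
  | .or φ ψ => .or φ.emb ψ.emb
  | .imp φ ψ => .imp φ.emb ψ.emb
  | .all φ => .all φ.emb
  | .ex φ => .ex φ.emb

/-- The fresh constant `aᵢ` occurs in no member of `Γ`. -/
def FreshIn (i : ℕ) (Γ : Set (Formula L.plus)) : Prop :=
  ∀ ψ ∈ Γ, ¬ ψ.OccC (Sum.inr i)

/-- A Kripke `L`-model (the frame conditions are packaged in `KModel.Proper`). -/
structure KModel (L : Signature) : Type (u + 1) where
  W : Type u
  acc : W → W → Prop
  D : Type u
  interpC : L.Const → D
  interpF : (f : L.Func) → (Fin (L.arityF f) → D) → D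
  interpR : (R : L.Rel) → W → Set (Fin (L.arityR R) → D)

/-- The conditions on an `L`-model: nonempty set of worlds, transitive accessibility
relation, nonempty domain, and the persistence constraint. -/
def KModel.Proper (M : KModel.{u} L) : Prop :=
  Nonempty M.W ∧ Nonempty M.D ∧ Transitive M.acc ∧
    ∀ (R : L.Rel) (w u' : M.W), M.acc w u' → M.interpR R w ⊆ M.interpR R u'

/-- Prepend a value to a valuation. -/
def vcons {α : Sort*} (d : α) (ρ : ℕ → α) : ℕ → α
  | 0 => d
  | n + 1 => ρ n

/-- Denotation of a term. -/
def Term.eval (M : KModel.{u} L) (ρ : ℕ → M.D) : Term L → M.D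
  | .var n => ρ n
  | .const c => M.interpC c
  | .func f ts => M.interpF f fun i => (ts i).eval M ρ

/-- The satisfaction relation `w ⊩ φ(ā)`. -/
def Sat (M : KModel.{u} L) : M.W → (ℕ → M.D) → Formula L → Prop
  | _, _, .top => True
  | _, _, .bot => False
  | w, ρ, .rel R ts => (fun i => (ts i).eval M ρ) ∈ M.interpR R w
  | w, ρ, .and φ ψ => Sat M w ρ φ ∧ Sat M w ρ ψ
  | w, ρ, .or φ ψ => Sat M w ρ φ ∨ Sat M w ρ ψ
  | w, ρ, .imp φ ψ => ∀ u', M.acc w u' → Sat M u' ρ φ → Sat M u' ρ ψ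
  | w, ρ, .all φ => ∀ d, Sat M w (vcons d ρ) φ
  | w, ρ, .ex φ => ∃ d, Sat M w (vcons d ρ) φ

/-- Satisfaction of a sentence (under every valuation). -/
def SatS (M : KModel.{u} L) (w : M.W) (φ : Formula L) : Prop := ∀ ρ, Sat M w ρ φ

/-- `Γ ⊨ φ`: truth is preserved at every reflexive world of every `L`-model. -/
def Models (Γ : Set (Formula L)) (φ : Formula L) : Prop :=
  ∀ M : KModel.{u} L, M.Proper → ∀ w : M.W, M.acc w w →
    (∀ ψ ∈ Γ, SatS M w ψ) → SatS M w φ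

/-- `Γ : Δ ⊨ φ`: for every `L`-model, every reflexive world `w` and every world `u ≻ w`:
if `w ⊩ Γ` and `u ⊩ Δ` then `u ⊩ φ`. -/
def ModelsCtx (Γ Δ : Set (Formula L)) (φ : Formula L) : Prop :=
  ∀ M : KModel.{u} L, M.Proper → ∀ w u' : M.W, M.acc w w → M.acc w u' →
    (∀ ψ ∈ Γ, SatS M w ψ) → (∀ ψ ∈ Δ, SatS M u' ψ) → SatS M u' φ

end BQL

namespace BQL

/-- `PrfN L n Γ Δ φ` formalizes `Γ : Δ ⊢_{[n-1]} φ`: there is a proof of `φ` in the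
system `NBQL_CD[n-1]` (so `PrfN L 0` is the system `NBQL_CD`, i.e. `⊢_{[-1]}`, which
has no modus ponens at all) whose open assumptions all belong to `Γ ∪ Δ` and in which
every open assumption occurring unsafely (i.e. in the right main subproof of an
application of the restricted modus ponens rule) belongs to `Γ`.  The restricted
modus ponens rule of `NBQL_CD[n-1]` requires its right main subproof to lie entirely
within `NBQL_CD[m-1]` for some `m < n`. -/
inductive PrfN (L : Signature) :
    ℕ → Set (Formula L.plus) → Set (Formula L.plus) → Formula L.plus → Prop
  | hyp {n Γ Δ φ} : φ ∈ Γ ∪ Δ → φ.Sentence → PrfN L n Γ Δ φ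
  | weaken {n Γ Γ' Δ Δ' φ} : Γ ⊆ Γ' → Δ ⊆ Δ' → PrfN L n Γ Δ φ → PrfN L n Γ' Δ' φ
  | topIntro {n Γ Δ} : PrfN L n Γ Δ .top
  | botElim {n Γ Δ φ} : φ.Sentence → PrfN L n Γ Δ .bot → PrfN L n Γ Δ φ
  | andIntro {n Γ Δ φ ψ} : PrfN L n Γ Δ φ → PrfN L n Γ Δ ψ → PrfN L n Γ Δ (.and φ ψ)
  | andElimL {n Γ Δ φ ψ} : PrfN L n Γ Δ (.and φ ψ) → PrfN L n Γ Δ φ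
  | andElimR {n Γ Δ φ ψ} : PrfN L n Γ Δ (.and φ ψ) → PrfN L n Γ Δ ψ
  | orIntroL {n Γ Δ φ ψ} : ψ.Sentence → PrfN L n Γ Δ φ → PrfN L n Γ Δ (.or φ ψ)
  | orIntroR {n Γ Δ φ ψ} : φ.Sentence → PrfN L n Γ Δ ψ → PrfN L n Γ Δ (.or φ ψ)
  | orElim {n Γ Δ φ ψ χ} : PrfN L n Γ Δ (.or φ ψ) → PrfN L n Γ (insert φ Δ) χ →
      PrfN L n Γ (insert ψ Δ) χ → PrfN L n Γ Δ χ
  | impIntro {n Γ Δ φ ψ} : φ.Sentence → PrfN L n Γ (insert φ Δ) ψ →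
      PrfN L n Γ Δ (.imp φ ψ)
  | impElim {n m Γ Δ φ ψ} : m < n → PrfN L n Γ Δ φ → PrfN L m Γ ∅ (.imp φ ψ) →
      PrfN L n Γ Δ ψ
  | intTrans {n Γ Δ φ ψ χ} : PrfN L n Γ Δ (.imp φ ψ) → PrfN L n Γ Δ (.imp ψ χ) →
      PrfN L n Γ Δ (.imp φ χ)
  | intAndIntro {n Γ Δ φ ψ χ} : PrfN L n Γ Δ (.imp φ ψ) → PrfN L n Γ Δ (.imp φ χ) →
      PrfN L n Γ Δ (.imp φ (.and ψ χ))
  | intOrElim {n Γ Δ φ ψ χ} : PrfN L n Γ Δ (.imp φ χ) → PrfN L n Γ Δ (.imp ψ χ) →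
      PrfN L n Γ Δ (.imp (.or φ ψ) χ)
  | intAllIntro {n Γ Δ φ ψ} : φ.Sentence → PrfN L n Γ Δ (.all (.imp φ ψ)) →
      PrfN L n Γ Δ (.imp φ (.all ψ))
  | intExElim {n Γ Δ φ ψ} : ψ.Sentence → PrfN L n Γ Δ (.all (.imp φ ψ)) →
      PrfN L n Γ Δ (.imp (.ex φ) ψ)
  | allIntro {n Γ Δ Γ' Δ' φ} {i : ℕ} : Γ' ⊆ Γ → Δ' ⊆ Δ → FreshIn i Γ' → FreshIn i Δ' →
      ¬ φ.OccC (Sum.inr i) → PrfN L n Γ' Δ' (subst0 φ (aconst L i)) →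
      PrfN L n Γ Δ (.all φ)
  | allElim {n Γ Δ φ} {t : Term L.plus} : t.Closed → PrfN L n Γ Δ (.all φ) →
      PrfN L n Γ Δ (subst0 φ t)
  | cd {n Γ Δ φ ψ} : φ.Sentence → PrfN L n Γ Δ (.all (.or φ ψ)) →
      PrfN L n Γ Δ (.or φ (.all ψ))
  | exIntro {n Γ Δ φ} {t : Term L.plus} : t.Closed → (Formula.ex φ).Sentence →
      PrfN L n Γ Δ (subst0 φ t) → PrfN L n Γ Δ (.ex φ)
  | exElim {n Γ Δ Γ' Δ' φ ψ} {i : ℕ} : Γ' ⊆ Γ → Δ' ⊆ Δ → FreshIn i Γ' → FreshIn i Δ' →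
      ¬ φ.OccC (Sum.inr i) → ¬ ψ.OccC (Sum.inr i) → PrfN L n Γ Δ (.ex φ) →
      PrfN L n Γ' (insert (subst0 φ (aconst L i)) Δ') ψ → PrfN L n Γ Δ ψ

/-- `Γ ⊢_{[-1]} φ`: there is a proof of `φ` from `Γ` in `NBQL_CD`
(the system `NBQL_CD^r` with `→`-Elim deleted). -/
def PrvB (L : Signature) (Γ : Set (Formula L.plus)) (φ : Formula L.plus) : Prop :=
  PrfN L 0 Γ ∅ φ

end BQL

namespace BQL

variable {L : Signature}

/-- Without modus ponens, no assumption occurs unsafely. -/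
theorem PrfN.to_right {Γ Δ : Set (Formula L.plus)} {φ : Formula L.plus}
    (h : PrfN L 0 Γ Δ φ) : PrfN L 0 ∅ (Γ ∪ Δ) φ := by
  generalize hk : (0 : ℕ) = k at h
  induction h with
  | hyp hmem hs => exact .hyp (Or.inr hmem) hs
  | weaken hΓ hΔ _ ih => exact .weaken subset_rfl (Set.union_subset_union hΓ hΔ) (ih hk)
  | topIntro => exact .topIntro
  | botElim hs _ ih => exact .botElim hs (ih hk)
  | andIntro _ _ ih₁ ih₂ => exact .andIntro (ih₁ hk) (ih₂ hk)
  | andElimL _ ih => exact .andElimL (ih hk)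
  | andElimR _ ih => exact .andElimR (ih hk)
  | orIntroL hs _ ih => exact .orIntroL hs (ih hk)
  | orIntroR hs _ ih => exact .orIntroR hs (ih hk)
  | orElim _ _ _ ih₁ ih₂ ih₃ =>
    have h₂ := ih₂ hk
    have h₃ := ih₃ hk
    rw [Set.union_insert] at h₂ h₃
    exact .orElim (ih₁ hk) h₂ h₃
  | impIntro hs _ ih =>
    have h := ih hk
    rw [Set.union_insert] at h
    exact .impIntro hs h
  | impElim hlt => omega
  | intTrans _ _ ih₁ ih₂ => exact .intTrans (ih₁ hk) (ih₂ hk)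
  | intAndIntro _ _ ih₁ ih₂ => exact .intAndIntro (ih₁ hk) (ih₂ hk)
  | intOrElim _ _ ih₁ ih₂ => exact .intOrElim (ih₁ hk) (ih₂ hk)
  | intAllIntro hs _ ih => exact .intAllIntro hs (ih hk)
  | intExElim hs _ ih => exact .intExElim hs (ih hk)
  | allIntro hΓ hΔ fΓ fΔ hφ _ ih =>
    exact .allIntro subset_rfl (Set.union_subset_union hΓ hΔ) (fun _ h => h.elim)
      (fun χ h => h.elim (fΓ χ) (fΔ χ)) hφ (ih hk)
  | allElim ht _ ih => exact .allElim ht (ih hk)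
  | cd hs _ ih => exact .cd hs (ih hk)
  | exIntro ht hs _ ih => exact .exIntro ht hs (ih hk)
  | exElim hΓ hΔ fΓ fΔ hφ hψ _ _ ih₁ ih₂ =>
    have h₂ := ih₂ hk
    rw [Set.union_insert] at h₂
    exact .exElim subset_rfl (Set.union_subset_union hΓ hΔ) (fun _ h => h.elim)
      (fun χ h => h.elim (fΓ χ) (fΔ χ)) hφ hψ (ih₁ hk) h₂

theorem PrfN.cut {n : ℕ} {Γ Δ : Set (Formula L.plus)} {φ ψ : Formula L.plus}
    (hs : φ.Sentence) (hφ : PrfN L n Γ Δ φ) (hψ : PrfN L n Γ (insert φ Δ) ψ) :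
    PrfN L n Γ Δ ψ :=
  .orElim (.orIntroL hs hφ) hψ hψ

theorem PrfN.cut_list {n : ℕ} {Γ Δ : Set (Formula L.plus)} {ψ : Formula L.plus}
    (l : List (Formula L.plus)) (hs : ∀ α ∈ l, α.Sentence) (hl : ∀ α ∈ l, PrfN L n Γ Δ α)
    (hψ : PrfN L n Γ ({α | α ∈ l} ∪ Δ) ψ) : PrfN L n Γ Δ ψ := by
  induction l with
  | nil => simpa using hψ
  | cons a l ih =>
    rw [List.forall_mem_cons] at hs hl
    refine ih hs.2 hl.2 (.cut hs.1 (.weaken subset_rfl Set.subset_union_right hl.1)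
      (.weaken subset_rfl ?_ hψ))
    rintro α (hα | hα)
    · exact (List.mem_cons.1 hα).imp id Or.inl
    · exact Or.inr (Or.inr hα)

/-- A finite list of sentences has a conjunction `c` such that `□c` follows from the boxed
members of the list. -/
theorem exists_conj (l : List (Formula L.plus)) (hs : ∀ α ∈ l, α.Sentence) :
    ∃ c : Formula L.plus, c.Sentence ∧
      (∀ (n : ℕ) (Γ Δ : Set (Formula L.plus)), PrfN L n Γ Δ c → ∀ α ∈ l, PrfN L n Γ Δ α) ∧
      ∀ (n : ℕ) (Γ Δ : Set (Formula L.plus)), (∀ α ∈ l, PrfN L n Γ Δ (.imp .top α)) →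
        PrfN L n Γ Δ (.imp .top c) := by
  induction l with
  | nil => exact ⟨.top, trivial, by simp, fun _ _ _ _ => .impIntro trivial .topIntro⟩
  | cons a l ih =>
    rw [List.forall_mem_cons] at hs
    obtain ⟨c, hc, helim, hbox⟩ := ih hs.2
    refine ⟨.and a c, ⟨hs.1, hc⟩, fun n Γ Δ h => ?_, fun n Γ Δ h => ?_⟩
    · exact List.forall_mem_cons.2 ⟨.andElimL h, helim n Γ Δ (.andElimR h)⟩
    · rw [List.forall_mem_cons] at h
      exact .intAndIntro h.1 (hbox n Γ Δ h.2)

theorem boxN_sentence {φ : Formula L} (hφ : φ.Sentence) (n : ℕ) : (boxN n φ).Sentence := by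
  induction n with
  | zero => exact hφ
  | succ n ih => exact ⟨trivial, ih⟩

theorem PrvB.box {l : List (Formula L.plus)} {Γ : Set (Formula L.plus)} {ψ : Formula L.plus}
    (hs : ∀ α ∈ l, α.Sentence) (hΓ : ∀ α ∈ l, .imp .top α ∈ Γ) (h : PrvB L {α | α ∈ l} ψ) :
    PrvB L Γ (.imp .top ψ) := by
  obtain ⟨c, hc, helim, hbox⟩ := exists_conj l hs
  have hcψ : PrfN L 0 Γ ∅ (.imp c ψ) := by
    refine .impIntro hc (.cut_list l hs (helim 0 _ _ (.hyp (by simp) hc)) ?_)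
    exact .weaken (Set.empty_subset _) (Set.union_subset_union_right _ (Set.empty_subset _))
      h.to_right
  exact .intTrans (hbox 0 Γ ∅ fun α hα => .hyp (Or.inl (hΓ α hα)) ⟨trivial, hs α hα⟩) hcψ

end BQL

namespace BQL

/-- **Regularity** (Lemma 5): if `φ₁, ..., φₘ ⊢_{[-1]} ψ` then
`□ⁿφ₁, ..., □ⁿφₘ ⊢_{[-1]} □ⁿψ`. -/
theorem regularity {L : Signature} (n : ℕ) (φs : List (Formula L.plus))
    (ψ : Formula L.plus) (hφs : ∀ α ∈ φs, Formula.Sentence α) (hψ : ψ.Sentence)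
    (h : PrvB L {α | α ∈ φs} ψ) :
    PrvB L {α | ∃ β ∈ φs, α = boxN n β} (boxN n ψ) := by
  induction n with
  | zero => simpa [boxN] using h
  | succ n ih =>
    refine PrvB.box (l := φs.map (boxN n)) ?_ ?_ ?_
    · simpa using fun α hα => boxN_sentence (hφs α hα) n
    · simpa using fun α hα => ⟨α, hα, rfl⟩
    · simpa [List.mem_map, eq_comm] using ih

end BQL
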